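/- A finite simple graph G is chordal if and only if there exists a tree T whose vertices are the maximal cliques of G such that, for every vertex v of G, the maximal cliques containing v induce a connected subtree of T. -/

import Mathlib

/-- A finite simple graph is *chordal* if every cycle of length at least 4 has a chord,
equivalently (and this is the formalization used here) it contains no induced cycle of
length at least 4. -/
def SimpleGraph.IsChordal {V : Type*} (G : SimpleGraph V) : Prop :=
  ∀ n : ℕ, 4 ≤ n → IsEmpty (SimpleGraph.cycleGraph n ↪g G)

/-- The type of maximal cliques (clusters) of `G`: cliques that are not properly
contained in any other clique of `G`. -/
def SimpleGraph.MaxClique {V : Type*} (G : SimpleGraph V) : Type _ :=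
  {s : Finset V // G.IsClique (s : Set V) ∧
    ∀ t : Finset V, G.IsClique (t : Set V) → s ⊆ t → s = t}

namespace JT
open SimpleGraph

/-- In a connected induced subgraph any two vertices are joined by a path staying inside. -/
lemma path_in {ι : Type*} {T : SimpleGraph ι} {A : Set ι} (h : (T.induce A).Connected)
    {a b : ι} (ha : a ∈ A) (hb : b ∈ A) :
    ∃ p : T.Walk a b, p.IsPath ∧ ∀ x ∈ p.support, x ∈ A := by
  classical
  obtain ⟨p, hp, -⟩ := h.exists_path_of_dist ⟨a, ha⟩ ⟨b, hb⟩
  refine ⟨p.map (Embedding.induce A).toHom,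
    Walk.IsPath.map (Embedding.induce (G := T) A).injective hp, ?_⟩
  intro x hx
  have hx' := (Walk.support_map (Embedding.induce (G := T) A).toHom p) ▸ hx
  obtain ⟨y, -, rfl⟩ := List.mem_map.1 hx'
  exact y.2

lemma desc {ι : Type*} {T : SimpleGraph ι} (hT : T.IsTree) {A : Set ι}
    (h : (T.induce A).Connected) {r t b : ι} (ht : t ∈ A) (hb : b ∈ A)
    (hmin : ∀ a ∈ A, T.dist r t ≤ T.dist r a) (w : T.Walk r b) : t ∈ w.support := by
  classical
  obtain ⟨q, hq, hql⟩ := hT.1.exists_path_of_dist r t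
  obtain ⟨p, hp, hpA⟩ := path_in h ht hb
  have hpath : (q.append p).IsPath := by
    rw [Walk.isPath_def, Walk.support_append, List.nodup_append]
    refine ⟨hq.support_nodup, hp.support_nodup.tail, ?_⟩
    rintro x hx y hy rfl
    have hxA := hpA x (List.mem_of_mem_tail hy)
    have hxt : x ≠ t := by
      rintro rfl
      have := hp.support_nodup
      rw [← Walk.cons_tail_support, List.nodup_cons] at this
      exact this.1 hy
    have h1 := Walk.length_takeUntil_lt_length hx hxt
    have h2 := dist_le (q.takeUntil x hx)
    have h3 := hmin x hxA
    omega
  have := (hT.2.subsingleton_path _ _).elim ⟨_, hpath⟩ w.toPath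
  have h2 : t ∈ (q.append p).support := by simp
  have h3 : q.append p = w.bypass := congrArg Subtype.val this
  rw [h3] at h2
  exact w.support_bypass_subset_support h2

lemma simplicial_of_tree {ι V : Type*} [Finite ι] {T : SimpleGraph ι} (hT : T.IsTree)
    (A : V → Set ι) (hA : ∀ v, (T.induce (A v)).Connected) (S : Finset V) (hS : S.Nonempty) :
    ∃ v ∈ S, ∃ t ∈ A v, ∀ u ∈ S, (A u ∩ A v).Nonempty → t ∈ A u := by
  classical
  obtain ⟨r⟩ := hT.1.nonempty
  have htop : ∀ v, ∃ t ∈ A v, ∀ a ∈ A v, T.dist r t ≤ T.dist r a := by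
    intro v
    have hne : (A v).Nonempty := by
      obtain ⟨x⟩ := (hA v).nonempty
      exact ⟨x.1, x.2⟩
    exact Set.exists_min_image _ _ (Set.toFinite _) hne
  choose t ht hmin using htop
  obtain ⟨v, hv, hmax⟩ := Finset.exists_max_image S (fun v => T.dist r (t v)) hS
  refine ⟨v, hv, t v, ht v, ?_⟩
  rintro u hu ⟨b, hbu, hbv⟩
  by_contra hn
  have hle := hmax u hu
  obtain ⟨p, -, hp⟩ := path_in (hA u) (ht u) hbu
  obtain ⟨q, hq, hql⟩ := hT.1.exists_path_of_dist r (t u)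
  have hmem := desc hT (hA v) (ht v) hbv (hmin v) (q.append p)
  rw [Walk.mem_support_append_iff] at hmem
  rcases hmem with hmem | hmem
  · have hne : t v ≠ t u := fun h => hn (h ▸ ht u)
    have h1 := Walk.length_takeUntil_lt_length hmem hne
    have h2 := dist_le (q.takeUntil _ hmem)
    omega
  · exact hn (hp _ hmem)

/-- Every clique extends to a maximal clique inside `S`. -/
def IsMC {V : Type*} (G : SimpleGraph V) (S K : Finset V) : Prop :=
  K ⊆ S ∧ G.IsClique (K : Set V) ∧ ∀ L ⊆ S, G.IsClique (L : Set V) → K ⊆ L → K = L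

lemma exists_mc {V : Type*} (G : SimpleGraph V) (S N : Finset V) (hN : N ⊆ S)
    (hc : G.IsClique (N : Set V)) : ∃ K, IsMC G S K ∧ N ⊆ K := by
  classical
  obtain ⟨K, hK, hmax⟩ := Finset.exists_max_image
    (S.powerset.filter fun K : Finset V => G.IsClique (K : Set V) ∧ N ⊆ K) Finset.card
    ⟨N, by simp [hN, hc]⟩
  simp only [Finset.mem_filter, Finset.mem_powerset] at hK hmax
  refine ⟨K, ⟨hK.1, hK.2.1, fun L hL hLc hKL => ?_⟩, hK.2.2⟩
  exact Finset.eq_of_subset_of_card_le hKL (hmax L ⟨hL, hLc, hK.2.2.trans hKL⟩)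

lemma isMC_univ {V : Type*} [Fintype V] (G : SimpleGraph V) (K : Finset V) :
    IsMC G Finset.univ K ↔ (G.IsClique (K : Set V) ∧
    ∀ t : Finset V, G.IsClique (t : Set V) → K ⊆ t → K = t) := by
  simp [IsMC]

lemma cyc_sub {n : ℕ} (hn : 3 ≤ n) (u v : Fin n) :
    (u - v).val = 1 ↔ u.val = v.val + 1 ∨ (u.val = 0 ∧ v.val + 1 = n) := by
  have hu := u.2
  have hv := v.2
  rcases le_or_gt v u with h | h
  · rw [Fin.coe_sub_iff_le.2 h]
    have : v.val ≤ u.val := h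
    omega
  · rw [Fin.coe_sub_iff_lt.2 h]
    have : u.val < v.val := h
    omega

lemma cyc_adj {n : ℕ} (hn : 3 ≤ n) (u v : Fin n) : (cycleGraph n).Adj u v ↔
    (u.val = v.val + 1 ∨ (u.val = 0 ∧ v.val + 1 = n)) ∨
    (v.val = u.val + 1 ∨ (v.val = 0 ∧ u.val + 1 = n)) := by
  rw [cycleGraph_adj', cyc_sub hn, cyc_sub hn]

theorem chordal_of_tree {V : Type*} [Fintype V] (G : SimpleGraph V)
    (T : SimpleGraph G.MaxClique) (hT : T.IsTree)
    (h : ∀ v : V, (T.induce {A : G.MaxClique | v ∈ A.1}).Connected) : G.IsChordal := by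
  classical
  intro n hn
  constructor
  intro φ
  have : Finite G.MaxClique := by unfold SimpleGraph.MaxClique; infer_instance
  obtain ⟨v, hv, t, htv, ht⟩ := simplicial_of_tree hT (fun v => {A : G.MaxClique | v ∈ A.1}) h
    (Finset.univ.image φ) ⟨φ ⟨0, by omega⟩, by simp⟩
  obtain ⟨i, -, rfl⟩ := Finset.mem_image.1 hv
  have key : ∀ j, (cycleGraph n).Adj i j → φ j ∈ t.1 := by
    intro j hj
    refine ht (φ j) (by simp) ?_
    have hadj : G.Adj (φ i) (φ j) := φ.map_adj_iff.2 hj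
    obtain ⟨K, hK, hsub⟩ := exists_mc G Finset.univ {φ i, φ j} (by simp) (by
      simp [hadj])
    exact ⟨⟨K, (isMC_univ G K).1 hK⟩, hsub (by simp), hsub (by simp)⟩
  have key2 : ∀ j k, (cycleGraph n).Adj i j → (cycleGraph n).Adj i k → j ≠ k →
      (cycleGraph n).Adj j k := by
    intro j k hj hk hjk
    exact φ.map_adj_iff.1 (t.2.1 (key j hj) (key k hk) (fun h => hjk (φ.injective h)))
  have hi := i.2
  let a : Fin n := if h : i.val + 1 < n then ⟨i.val + 1, h⟩ else ⟨0, by omega⟩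
  let b : Fin n := if h : i.val = 0 then ⟨n - 1, by omega⟩ else ⟨i.val - 1, by omega⟩
  have ha : a.val = if i.val + 1 < n then i.val + 1 else 0 := by
    simp only [a]; split_ifs <;> rfl
  have hb : b.val = if i.val = 0 then n - 1 else i.val - 1 := by
    simp only [b]; split_ifs <;> rfl
  have := key2 a b ((cyc_adj (by omega) _ _).2 (by split_ifs at ha <;> omega))
    ((cyc_adj (by omega) _ _).2 (by split_ifs at hb <;> omega))
    (by rw [Ne, Fin.ext_iff]; split_ifs at ha hb <;> omega)
  rw [cyc_adj (by omega)] at this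
  split_ifs at ha hb <;> omega

lemma no_hole {V : Type*} {G : SimpleGraph V} (hG : G.IsChordal) (m : ℕ) (hm : 2 ≤ m)
    (p : ℕ → V) (d : V) (hinj : ∀ i ≤ m, ∀ j ≤ m, p i = p j → i = j)
    (hp : ∀ i ≤ m, ∀ j ≤ m, (G.Adj (p i) (p j) ↔ i + 1 = j ∨ j + 1 = i))
    (hdp : ∀ i ≤ m, d ≠ p i) (hd : ∀ i ≤ m, (G.Adj d (p i) ↔ i = 0 ∨ i = m)) : False := by
  refine (hG (m + 2) (by omega)).false ⟨⟨fun i => if i.val ≤ m then p i.val else d, ?_⟩, ?_⟩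
  · intro i j hij
    have hi := i.2
    have hj := j.2
    simp only at hij
    rw [Fin.ext_iff]
    split_ifs at hij with h1 h2 h2
    · exact hinj _ h1 _ h2 hij
    · exact absurd hij.symm (hdp _ h1)
    · exact absurd hij (hdp _ h2)
    · omega
  · intro i j
    have hi := i.2
    have hj := j.2
    change G.Adj (if i.val ≤ m then p i.val else d) (if j.val ≤ m then p j.val else d) ↔ _
    rw [cyc_adj (by omega)]
    split_ifs with h1 h2 h2
    · rw [hp _ h1 _ h2]; omega
    · rw [G.adj_comm, hd _ h1]; omega
    · rw [hd _ h2]; omega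
    · have := G.irrefl (v := d)
      simp only [this, false_iff]; omega

/-- If `x`, `y` are joined through `W` and `d` sees only `x`, `y` in `W`, then `x` and `y` are
adjacent. -/
lemma adj_of_sep {V : Type*} {G : SimpleGraph V} (hG : G.IsChordal) (W : Set V)
    (hW : (G.induce W).Connected) {x y d : V} (hx : x ∈ W) (hy : y ∈ W) (hxy : x ≠ y)
    (hdW : d ∉ W) (hdx : G.Adj d x) (hdy : G.Adj d y)
    (hd : ∀ w ∈ W, G.Adj d w → w = x ∨ w = y) : G.Adj x y := by
  by_contra hn
  obtain ⟨p, hp, hl⟩ := hW.exists_path_of_dist ⟨x, hx⟩ ⟨y, hy⟩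
  have hm : 2 ≤ p.length := by
    rw [hl]
    exact hW.one_lt_dist_of_ne_of_not_adj (by simpa using hxy) (by simpa using hn)
  have h0 : p.getVert 0 = ⟨x, hx⟩ := p.getVert_zero
  have h1 : p.getVert p.length = ⟨y, hy⟩ := p.getVert_length
  have hinj : ∀ i ≤ p.length, ∀ j ≤ p.length, p.getVert i = p.getVert j → i = j :=
    fun i hi j hj h => hp.getVert_injOn hi hj h
  have hlt : ∀ i j, i < j → j ≤ p.length → (G.induce W).Adj (p.getVert i) (p.getVert j) →
      j = i + 1 := by
    intro i j hij hj hadj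
    have := dist_le ((p.take i).append ((p.drop j).cons hadj))
    rw [← hl] at this
    simp at this
    omega
  refine no_hole hG p.length hm (fun i => (p.getVert i).1) d ?_ ?_ ?_ ?_
  · intro i hi j hj h
    exact hinj i hi j hj (Subtype.ext h)
  · intro i hi j hj
    constructor
    · intro h
      rcases lt_trichotomy i j with hij | hij | hij
      · have := hlt i j hij hj h
        omega
      · subst hij
        exact absurd h G.irrefl
      · have := hlt j i hij hi h.symm
        omega
    · rintro (rfl | rfl)
      · exact p.adj_getVert_succ (by omega)
      · exact (p.adj_getVert_succ (i := j) (by omega)).symm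
  · rintro i - rfl
    exact hdW (p.getVert i).2
  · intro i hi
    constructor
    · intro h
      rcases hd _ (p.getVert i).2 h with h | h
      · left
        exact hinj i hi 0 (by omega) (by rw [h0]; exact Subtype.ext h)
      · right
        exact hinj i hi _ le_rfl (by rw [h1]; exact Subtype.ext h)
    · rintro (rfl | rfl)
      · simpa [h0] using hdx
      · simpa [h1] using hdy

lemma conn_insert {V : Type*} {G : SimpleGraph V} {C : Set V} (hC : (G.induce C).Connected)
    {c x : V} (hc : c ∈ C) (h : G.Adj c x) : (G.induce (insert x C)).Connected := by
  have h1 := induce_pair_connected_of_adj h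
  have h2 := induce_union_connected hC.preconnected h1.preconnected ⟨c, hc, by simp⟩
  have h3 : C ∪ {c, x} = insert x C := by
    ext z
    simp only [Set.mem_union, Set.mem_insert_iff, Set.mem_singleton_iff]
    constructor
    · rintro (h | rfl | h) <;> simp_all
    · rintro (h | h) <;> simp_all
  rwa [h3] at h2

theorem exists_simplicial {V : Type*} {G : SimpleGraph V} (hG : G.IsChordal) (S : Finset V)
    (hS : S.Nonempty) : ∃ v ∈ S, ∀ a ∈ S, ∀ b ∈ S, G.Adj v a → G.Adj v b → a ≠ b →
      G.Adj a b := by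
  classical
  induction S using Finset.strongInduction with
  | H S ih =>
  by_cases hcomp : ∀ a ∈ S, ∀ b ∈ S, a ≠ b → G.Adj a b
  · obtain ⟨v, hv⟩ := hS
    exact ⟨v, hv, fun a ha b hb _ _ hab => hcomp a ha b hb hab⟩
  push Not at hcomp
  obtain ⟨s, hs, d₀, hd₀, hne, hnadj⟩ := hcomp
  obtain ⟨C, hC, hmax⟩ := Finset.exists_max_image
    (S.powerset.filter fun C : Finset V => (G.induce (C : Set V)).Connected ∧
      ∃ d ∈ S, d ∉ C ∧ ∀ c ∈ C, ¬ G.Adj d c) Finset.card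
    ⟨{s}, by
      simp only [Finset.mem_filter, Finset.mem_powerset, Finset.singleton_subset_iff]
      refine ⟨hs, ?_, d₀, hd₀, by simpa using hne.symm, ?_⟩
      · rw [Finset.coe_singleton]
        have : Subsingleton ({s} : Set V) := inferInstance
        exact (IsTree.of_subsingleton).1
      · simpa [G.adj_comm] using hnadj⟩
  simp only [Finset.mem_filter, Finset.mem_powerset] at hC hmax
  obtain ⟨hCS, hCc, d, hdS, hdC, hdn⟩ := hC
  have hfull : ∀ x ∈ S, x ∉ C → (∃ c ∈ C, G.Adj c x) →
      ∀ e ∈ S, e ∉ C → (∀ c ∈ C, ¬ G.Adj e c) → G.Adj e x := by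
    rintro x hx hxC ⟨c, hc, hcx⟩ e he heC hen
    by_contra hcon
    have := hmax (insert x C) ⟨Finset.insert_subset hx hCS, by
      rw [Finset.coe_insert]
      exact conn_insert hCc (Finset.mem_coe.2 hc) hcx, e, he, by
        rw [Finset.mem_insert, not_or]
        exact ⟨fun h => hen c hc (h ▸ hcx.symm), heC⟩, by
        intro z hz
        rcases Finset.mem_insert.1 hz with rfl | hz
        · exact hcon
        · exact hen z hz⟩
    rw [Finset.card_insert_of_notMem hxC] at this
    omega
  have hclique : ∀ x ∈ S, x ∉ C → (∃ c ∈ C, G.Adj c x) →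
      ∀ y ∈ S, y ∉ C → (∃ c ∈ C, G.Adj c y) → x ≠ y → G.Adj x y := by
    intro x hx hxC hxc y hy hyC hyc hxy
    have hdx := hfull x hx hxC hxc d hdS hdC hdn
    have hdy := hfull y hy hyC hyc d hdS hdC hdn
    obtain ⟨c, hc, hcx⟩ := hxc
    obtain ⟨c', hc', hcy⟩ := hyc
    have hW := conn_insert (conn_insert hCc (Finset.mem_coe.2 hc) hcx)
      (Set.mem_insert_of_mem x (Finset.mem_coe.2 hc')) hcy
    refine adj_of_sep hG _ hW (by simp) (by simp) hxy ?_ hdx hdy ?_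
    · simp only [Set.mem_insert_iff, Finset.mem_coe, not_or]
      exact ⟨hdy.ne, hdx.ne, hdC⟩
    · intro w hw hdw
      rcases hw with rfl | rfl | hw
      · exact Or.inr rfl
      · exact Or.inl rfl
      · exact absurd hdw (hdn w hw)
  obtain ⟨v, hv, hsimp⟩ := ih (S.filter fun e => e ∉ C ∧ ∀ c ∈ C, ¬ G.Adj e c)
    (by
      obtain ⟨⟨c, hc⟩⟩ := hCc.nonempty
      refine Finset.filter_ssubset.2 ⟨c, hCS hc, ?_⟩
      exact fun h => h.1 hc)
    ⟨d, by simp only [Finset.mem_filter]; exact ⟨hdS, hdC, hdn⟩⟩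
  simp only [Finset.mem_filter] at hv hsimp
  obtain ⟨hvS, hvC, hvn⟩ := hv
  refine ⟨v, hvS, fun a ha b hb hva hvb hab => ?_⟩
  have haC : a ∉ C := fun h => hvn a h hva
  have hbC : b ∉ C := fun h => hvn b h hvb
  by_cases h1 : ∃ c ∈ C, G.Adj c a
  · by_cases h2 : ∃ c ∈ C, G.Adj c b
    · exact hclique a ha haC h1 b hb hbC h2 hab
    · exact (hfull a ha haC h1 b hb hbC (fun c hc h => h2 ⟨c, hc, h.symm⟩)).symm
  · have h1' : ∀ c ∈ C, ¬ G.Adj a c := fun c hc h => h1 ⟨c, hc, h.symm⟩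
    by_cases h2 : ∃ c ∈ C, G.Adj c b
    · exact hfull b hb hbC h2 a ha haC h1'
    · exact hsimp a ⟨ha, haC, h1'⟩ b ⟨hb, hbC, fun c hc h => h2 ⟨c, hc, h.symm⟩⟩ hva hvb hab

/-- Adding a leaf `none` attached to `some k`. -/
def addLeaf {ι : Type} (T : SimpleGraph ι) (k : ι) : SimpleGraph (Option ι) :=
  T.map some ⊔ edge none (some k)

lemma addLeaf_some {ι : Type} (T : SimpleGraph ι) (k a b : ι) (h : T.Adj a b) :
    (addLeaf T k).Adj (some a) (some b) := by
  unfold addLeaf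
  rw [sup_adj]
  left
  exact map_adj_apply' h (by simpa using h.ne)

lemma addLeaf_none {ι : Type} (T : SimpleGraph ι) (k : ι) :
    (addLeaf T k).Adj (some k) none := by
  unfold addLeaf
  rw [sup_adj, edge_adj]
  right
  simp

lemma map_some_acyclic {ι : Type} (T : SimpleGraph ι) (k : ι) (h : T.IsAcyclic) :
    (T.map (some : ι → Option ι)).IsAcyclic := by
  rw [isAcyclic_iff_free_cycleGraph] at h ⊢
  rintro n hn ⟨f⟩
  refine h n hn ⟨⟨⟨fun i => (f i).getD k, ?_⟩, ?_⟩⟩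
  · intro a b hab
    have := f.toHom.map_adj hab
    rw [map_adj'] at this
    obtain ⟨-, u, v, huv, hu, hv⟩ := this
    change T.Adj ((f a).getD k) ((f b).getD k)
    have hu' : f a = some u := hu.symm
    have hv' : f b = some v := hv.symm
    rw [hu', hv']
    exact huv
  · have hs : ∀ a, ∃ u, f a = some u := by
      intro a
      obtain ⟨b, hab⟩ : ∃ b, (cycleGraph n).Adj a b := by
        have ha := a.2
        by_cases h : a.val + 1 < n
        · exact ⟨⟨a.val + 1, h⟩, (cyc_adj hn _ _).2 (by simp)⟩
        · exact ⟨⟨0, by omega⟩, (cyc_adj hn _ _).2 (by simp; omega)⟩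
      have := f.toHom.map_adj hab
      rw [map_adj'] at this
      obtain ⟨-, u, v, huv, hu, hv⟩ := this
      exact ⟨u, hu.symm⟩
    intro a b hab
    obtain ⟨u, hu⟩ := hs a
    obtain ⟨v, hv⟩ := hs b
    change (f a).getD k = (f b).getD k at hab
    rw [hu, hv] at hab
    apply f.injective
    change f a = f b
    rw [hu, hv]
    exact congrArg some hab

lemma addLeaf_conn {ι : Type} (T : SimpleGraph ι) (k : ι) (A : Set ι)
    (hA : (T.induce A).Connected) : ((addLeaf T k).induce (some '' A)).Connected := by
  let f : T.induce A →g (addLeaf T k).induce (some '' A) :=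
    ⟨fun a => ⟨some a.1, a.1, a.2, rfl⟩, fun {a b} h => addLeaf_some T k a.1 b.1 h⟩
  refine hA.map f ?_
  rintro ⟨_, a, ha, rfl⟩
  exact ⟨⟨a, ha⟩, rfl⟩

lemma addLeaf_conn' {ι : Type} (T : SimpleGraph ι) (k : ι) (A : Set ι) (hk : k ∈ A)
    (hA : (T.induce A).Connected) :
    ((addLeaf T k).induce (insert none (some '' A))).Connected :=
  conn_insert (addLeaf_conn T k A hA) ⟨k, hk, rfl⟩ (addLeaf_none T k)

lemma addLeaf_tree {ι : Type} (T : SimpleGraph ι) (k : ι) (hT : T.IsTree) :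
    (addLeaf T k).IsTree := by
  constructor
  · have h1 : (T.induce Set.univ).Connected := (induceUnivIso T).connected_iff.2 hT.1
    have h2 := addLeaf_conn' T k _ (Set.mem_univ k) h1
    have h3 : insert none (some '' (Set.univ : Set ι)) = Set.univ := by
      ext x; cases x <;> simp
    rw [h3] at h2
    exact (induceUnivIso _).connected_iff.1 h2
  · refine IsAcyclic.sup_edge_of_not_reachable ?_ (map_some_acyclic T k hT.2)
    rintro ⟨w⟩
    cases w with
    | cons h _ =>
      rw [map_adj'] at h
      obtain ⟨-, u, v, -, hu, -⟩ := h
      cases hu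

lemma conn_singleton {V : Type*} (G : SimpleGraph V) (s : V) :
    (G.induce ({s} : Set V)).Connected := (IsTree.of_subsingleton).1

lemma isMC_step {V : Type*} [DecidableEq V] {G : SimpleGraph V} {S N : Finset V} {v : V}
    (hv : v ∈ S) (hN : ∀ u, u ∈ N ↔ u ∈ S ∧ G.Adj v u) (hc : G.IsClique (N : Set V))
    (L : Finset V) :
    IsMC G S L ↔ L = insert v N ∨ (IsMC G (S.erase v) L ∧ L ≠ N) := by
  have hvN : v ∉ N := fun h => G.irrefl ((hN v).1 h).2
  have hcv : G.IsClique ((insert v N : Finset V) : Set V) := by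
    rw [Finset.coe_insert, isClique_insert]
    exact ⟨hc, fun b hb _ => ((hN b).1 hb).2⟩
  have hsub : insert v N ⊆ S := Finset.insert_subset hv fun u hu => ((hN u).1 hu).1
  have hle : ∀ L ⊆ S, G.IsClique (L : Set V) → v ∈ L → L ⊆ insert v N := by
    intro L hL hLc hvL u hu
    rw [Finset.mem_insert]
    by_cases huv : u = v
    · exact Or.inl huv
    · exact Or.inr ((hN u).2 ⟨hL hu, hLc hvL hu (Ne.symm huv)⟩)
  constructor
  · rintro ⟨hLS, hLc, hmax⟩
    by_cases hvL : v ∈ L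
    · exact Or.inl (hmax _ hsub hcv (hle L hLS hLc hvL))
    · refine Or.inr ⟨⟨fun u hu => Finset.mem_erase.2 ⟨fun h => hvL (h ▸ hu), hLS hu⟩, hLc,
        fun M hM hMc hLM => hmax M (hM.trans (Finset.erase_subset _ _)) hMc hLM⟩, ?_⟩
      rintro rfl
      have := hmax _ hsub hcv (Finset.subset_insert _ _)
      exact hvL (this ▸ Finset.mem_insert_self _ _)
  · rintro (rfl | ⟨⟨hLS, hLc, hmax⟩, hne⟩)
    · exact ⟨hsub, hcv, fun M hM hMc hsM =>
        hsM.antisymm (hle M hM hMc (hsM (Finset.mem_insert_self _ _)))⟩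
    · refine ⟨hLS.trans (Finset.erase_subset _ _), hLc, fun M hM hMc hLM => ?_⟩
      by_cases hvM : v ∈ M
      · exfalso
        apply hne
        refine hmax N (fun u hu => Finset.mem_erase.2 ⟨fun h => hvN (h ▸ hu), ((hN u).1 hu).1⟩)
          hc (fun u hu => ?_)
        have := hle M hM hMc hvM (hLM hu)
        rw [Finset.mem_insert] at this
        exact this.resolve_left (Finset.mem_erase.1 (hLS hu)).1
      · exact hmax M (fun u hu => Finset.mem_erase.2 ⟨fun h => hvM (h ▸ hu), hM hu⟩) hMc hLM

theorem exists_tree {V : Type*} {G : SimpleGraph V} (hG : G.IsChordal) (n : ℕ) :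
    ∀ S : Finset V, S.card = n → ∃ (ι : Type) (T : SimpleGraph ι) (f : ι → Finset V),
      T.IsTree ∧ Function.Injective f ∧ (∀ K, IsMC G S K ↔ ∃ i, f i = K) ∧
      ∀ v ∈ S, (T.induce {i | v ∈ f i}).Connected := by
  classical
  induction n with
  | zero =>
    intro S hS
    rw [Finset.card_eq_zero] at hS
    subst hS
    refine ⟨Unit, ⊥, fun _ => ∅, IsTree.of_subsingleton, fun _ _ _ => rfl, ?_, by simp⟩
    intro K
    constructor
    · rintro ⟨h, -⟩
      exact ⟨(), (Finset.subset_empty.1 h).symm⟩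
    · rintro ⟨-, rfl⟩
      exact ⟨le_rfl, by simp, fun L hL _ _ => (Finset.subset_empty.1 hL).symm⟩
  | succ n ih =>
    intro S hS
    obtain ⟨v, hv, hsimp⟩ := exists_simplicial hG S (Finset.card_pos.1 (by omega))
    obtain ⟨ι, T, f, hT, hf, hmc, hconn⟩ := ih (S.erase v) (by
      rw [Finset.card_erase_of_mem hv]; omega)
    obtain ⟨N, hN⟩ : ∃ N : Finset V, ∀ u, u ∈ N ↔ u ∈ S ∧ G.Adj v u :=
      ⟨S.filter (fun u => G.Adj v u), by simp⟩
    have hc : G.IsClique (N : Set V) := by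
      intro a ha b hb hab
      have ha' := (hN a).1 ha
      have hb' := (hN b).1 hb
      exact hsimp a ha'.1 b hb'.1 ha'.2 hb'.2 hab
    have hstep := fun L => isMC_step (L := L) hv hN hc
    have hvN : v ∉ N := fun h => G.irrefl ((hN v).1 h).2
    have hNS : N ⊆ S.erase v :=
      fun u hu => Finset.mem_erase.2 ⟨fun h => hvN (h ▸ hu), ((hN u).1 hu).1⟩
    have hfmc : ∀ i, IsMC G (S.erase v) (f i) := fun i => (hmc _).2 ⟨i, rfl⟩
    have hvf : ∀ i, v ∉ f i := fun i h => (Finset.mem_erase.1 ((hfmc i).1 h)).1 rfl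
    obtain ⟨K, hK, hNK⟩ := exists_mc G (S.erase v) N hNS hc
    obtain ⟨k, rfl⟩ := (hmc K).1 hK
    by_cases hk : f k = N
    · refine ⟨ι, T, Function.update f k (insert v N), hT, ?_, ?_, ?_⟩
      · intro i j hij
        by_cases hi : i = k <;> by_cases hj : j = k
        · rw [hi, hj]
        · subst hi
          rw [Function.update_self, Function.update_of_ne hj] at hij
          exact absurd (hij ▸ Finset.mem_insert_self v N) (hvf j)
        · subst hj
          rw [Function.update_self, Function.update_of_ne hi] at hij
          exact absurd (hij ▸ Finset.mem_insert_self v N) (hvf i)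
        · rw [Function.update_of_ne hi, Function.update_of_ne hj] at hij
          exact hf hij
      · intro L
        rw [hstep]
        constructor
        · rintro (rfl | ⟨hL, hne⟩)
          · exact ⟨k, Function.update_self ..⟩
          · obtain ⟨i, rfl⟩ := (hmc L).1 hL
            refine ⟨i, Function.update_of_ne ?_ ..⟩
            rintro rfl
            exact hne hk
        · rintro ⟨i, rfl⟩
          by_cases hi : i = k
          · subst hi
            exact Or.inl (Function.update_self ..)
          · rw [Function.update_of_ne hi]
            exact Or.inr ⟨hfmc i, fun h => hi (hf (h.trans hk.symm))⟩
      · intro u hu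
        by_cases huv : u = v
        · subst huv
          have : {i | u ∈ Function.update f k (insert u N) i} = {k} := by
            ext i
            by_cases hi : i = k
            · subst hi; simp
            · simp [hi, hvf i]
          rw [this]
          exact conn_singleton T k
        · have : {i | u ∈ Function.update f k (insert v N) i} = {i | u ∈ f i} := by
            ext i
            by_cases hi : i = k
            · subst hi; simp [huv, hk]
            · simp [hi]
          rw [this]
          exact hconn u (Finset.mem_erase.2 ⟨huv, hu⟩)
    · have hne : ∀ i, f i ≠ N := by
        intro i hi
        have := (hfmc i).2.2 (f k) (hfmc k).1 (hfmc k).2.1 (hi ▸ hNK)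
        exact hk (this ▸ hi)
      let g : Option ι → Finset V := fun o => o.elim (insert v N) f
      refine ⟨Option ι, addLeaf T k, g, addLeaf_tree T k hT, ?_, ?_, ?_⟩
      · rintro (_ | i) (_ | j) hij
        · rfl
        · have hij' : insert v N = f j := hij
          exact absurd (hij' ▸ Finset.mem_insert_self v N) (hvf j)
        · have hij' : f i = insert v N := hij
          exact absurd (hij' ▸ Finset.mem_insert_self v N) (hvf i)
        · exact congrArg some (hf hij)
      · intro L
        rw [hstep]
        constructor
        · rintro (rfl | ⟨hL, -⟩)
          · exact ⟨none, rfl⟩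
          · obtain ⟨i, rfl⟩ := (hmc L).1 hL
            exact ⟨some i, rfl⟩
        · rintro ⟨_ | i, rfl⟩
          · exact Or.inl rfl
          · exact Or.inr ⟨hfmc i, hne i⟩
      · intro u hu
        by_cases huv : u = v
        · subst huv
          have : {i | u ∈ g i} = {none} := by
            ext i
            cases i <;> simp [g, hvf]
          rw [this]
          exact conn_singleton _ _
        · have hA := hconn u (Finset.mem_erase.2 ⟨huv, hu⟩)
          by_cases huN : u ∈ N
          · have : {i | u ∈ g i} = insert none (some '' {i | u ∈ f i}) := by
              ext i
              cases i <;> simp [g, huN]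
            rw [this]
            exact addLeaf_conn' T k _ (hNK huN) hA
          · have : {i | u ∈ g i} = some '' {i | u ∈ f i} := by
              ext i
              cases i <;> simp [g, huN, huv]
            rw [this]
            exact addLeaf_conn T k _ hA

theorem tree_of_chordal {V : Type*} [Fintype V] (G : SimpleGraph V) (hG : G.IsChordal) :
    ∃ T : SimpleGraph G.MaxClique, T.IsTree ∧
        ∀ v : V, (T.induce {A : G.MaxClique | v ∈ A.1}).Connected := by
  obtain ⟨ι, T, f, hT, hf, hmc, hconn⟩ := exists_tree hG _ Finset.univ rfl
  have hfm : ∀ i, _ := fun i => (isMC_univ G (f i)).1 ((hmc _).2 ⟨i, rfl⟩)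
  let e : ι ≃ G.MaxClique := Equiv.ofBijective (fun i => ⟨f i, hfm i⟩) ⟨by
    intro i j hij
    exact hf (congrArg Subtype.val hij), by
    rintro ⟨K, hK⟩
    obtain ⟨i, rfl⟩ := (hmc K).1 ((isMC_univ G K).2 hK)
    exact ⟨i, rfl⟩⟩
  let T' : SimpleGraph G.MaxClique := T.comap e.symm
  let φ : T' ≃g T := ⟨e.symm, Iff.rfl⟩
  refine ⟨T', φ.isTree_iff.2 hT, fun v => ?_⟩
  let ψ : T.induce {i | v ∈ f i} →g T'.induce {A : G.MaxClique | v ∈ A.1} :=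
    ⟨fun i => ⟨e i.1, i.2⟩, fun {a b} h => by
      change T.Adj (e.symm (e a.1)) (e.symm (e b.1))
      rw [e.symm_apply_apply, e.symm_apply_apply]
      exact h⟩
  refine (hconn v (Finset.mem_univ v)).map ψ ?_
  rintro ⟨A, hA⟩
  obtain ⟨i, rfl⟩ := e.surjective A
  exact ⟨⟨i, hA⟩, rfl⟩

end JT

/-- A finite simple graph `G` is chordal if and only if there exists a tree `T` whose
vertices are the maximal cliques of `G` such that, for every vertex `v` of `G`, the
maximal cliques containing `v` induce a connected subtree of `T`. -/
theorem isChordal_iff_exists_junctionTree {V : Type*} [Fintype V] (G : SimpleGraph V) :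
    G.IsChordal ↔
      ∃ T : SimpleGraph G.MaxClique, T.IsTree ∧
        ∀ v : V, (T.induce {A : G.MaxClique | v ∈ A.1}).Connected := by
  exact ⟨JT.tree_of_chordal G, fun ⟨T, hT, h⟩ => JT.chordal_of_tree G T hT h⟩
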